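/- Let τ be a k-tangle in a graph G with k ≥ 3. Suppose G has a vertex v of degree 1 and let e be the unique edge incident to v. Then τ extends to exactly one k-tangle τ' in G − e. -/

import Mathlib

open Finset

variable {V : Type} [Fintype V] [DecidableEq V]

/-- `{A, B}` is a separation of the graph `G`: the two sides together cover the vertex set and
no edge of `G` joins `A \ B` to `B \ A`. -/
def IsSep (G : SimpleGraph V) (A B : Finset V) : Prop :=
  A ∪ B = Finset.univ ∧ ∀ a ∈ A \ B, ∀ b ∈ B \ A, ¬ G.Adj a b

/-- `G[A₁] ∪ G[A₂] ∪ G[A₃] = G` for the induced subgraphs on `A₁`, `A₂`, `A₃`. -/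
def CoversG (G : SimpleGraph V) (A₁ A₂ A₃ : Finset V) : Prop :=
  (∀ v : V, v ∈ A₁ ∨ v ∈ A₂ ∨ v ∈ A₃) ∧
    ∀ u v : V, G.Adj u v →
      (u ∈ A₁ ∧ v ∈ A₁) ∨ (u ∈ A₂ ∧ v ∈ A₂) ∨ (u ∈ A₃ ∧ v ∈ A₃)

/-- `τ` is a `k`-tangle in `G`: a set of oriented separations of order `< k` containing exactly
one orientation of every separation of order `< k`, and no three of its elements have small
sides whose induced subgraphs together cover `G`. -/
def IsTangle (G : SimpleGraph V) (k : ℕ) (τ : Set (Finset V × Finset V)) : Prop :=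
  (∀ p ∈ τ, IsSep G p.1 p.2 ∧ (p.1 ∩ p.2).card < k) ∧
    (∀ A B : Finset V, IsSep G A B → (A ∩ B).card < k → ((A, B) ∈ τ ↔ (B, A) ∉ τ)) ∧
    ∀ p₁ ∈ τ, ∀ p₂ ∈ τ, ∀ p₃ ∈ τ, ¬ CoversG G p₁.1 p₂.1 p₃.1

/-- Both orientations of a separation cannot lie in a tangle. -/
theorem IsTangle.mem_swap {H : SimpleGraph V} {k : ℕ} {τ : Set (Finset V × Finset V)}
    (hτ : IsTangle H k τ) {A B : Finset V} (hs : IsSep H A B) (hc : (A ∩ B).card < k)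
    (h : (A, B) ∉ τ) : (B, A) ∈ τ := by
  have := hτ.2.1 A B hs hc
  tauto

/-- In a tangle of order at least `3`, every set of two vertices is the small side of the
separation whose other side is the whole vertex set. -/
theorem IsTangle.pair_mem {H : SimpleGraph V} {k : ℕ} {τ : Set (Finset V × Finset V)}
    (hk : 3 ≤ k) (hτ : IsTangle H k τ) (v u : V) : (({v, u} : Finset V), Finset.univ) ∈ τ := by
  by_contra h
  have hm : (Finset.univ, ({v, u} : Finset V)) ∈ τ := by
    refine hτ.mem_swap ⟨by simp, fun a ha => by simp at ha⟩ ?_ h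
    have : ({v, u} : Finset V).card ≤ 2 := Finset.card_le_two
    simp only [Finset.inter_univ]
    omega
  exact hτ.2.2 _ hm _ hm _ hm ⟨by simp, by simp⟩

/-- If `u` is the only possible neighbour of `v`, then a tangle of order at least `3` orients
separations that differ only in `v` in the same way. -/
theorem IsTangle.mem_of_erase_eq {H : SimpleGraph V} {k : ℕ} {τ : Set (Finset V × Finset V)}
    (hk : 3 ≤ k) (hτ : IsTangle H k τ) {v u : V} (hdeg : ∀ x : V, H.Adj v x → x = u)
    {A B A' B' : Finset V} (hm : (A, B) ∈ τ) (hs : IsSep H A' B') (hc : (A' ∩ B').card < k)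
    (hA : A'.erase v = A.erase v) (hB : B'.erase v = B.erase v) : (A', B') ∈ τ := by
  by_contra h
  have hA' : ∀ x, x ≠ v → (x ∈ A' ↔ x ∈ A) := fun x hx => by
    simpa [hx] using Finset.ext_iff.1 hA x
  refine hτ.2.2 _ hm _ (hτ.mem_swap hs hc h) _ (hτ.pair_mem hk v u) ⟨fun x => ?_, fun x y hxy => ?_⟩
  · by_cases hx : x = v
    · simp [hx]
    · have := Finset.ext_iff.1 hs.1 x
      simp only [Finset.mem_union, Finset.mem_univ, iff_true] at this
      have := hA' x hx
      tauto
  · by_cases hx : x = v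
    · subst hx
      simp [hdeg y hxy]
    by_cases hy : y = v
    · subst hy
      simp [hdeg x hxy.symm]
    have hx' := Finset.ext_iff.1 hs.1 x
    have hy' := Finset.ext_iff.1 hs.1 y
    simp only [Finset.mem_union, Finset.mem_univ, iff_true] at hx' hy'
    have h₁ := hs.2 x
    have h₂ := hs.2 y
    simp only [Finset.mem_sdiff] at h₁ h₂
    have h₃ := fun h h' => h₁ h y h' hxy
    have h₄ := fun h h' => h₂ h x h' hxy.symm
    rw [← hA' x hx, ← hA' y hy]
    clear h₁ h₂
    by_cases x ∈ A' <;> by_cases y ∈ A' <;> simp_all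

/-- A separation of `G - vu`, where `v` is a leaf of `G` with neighbour `u`, becomes a separation
of `G` of no larger order when `v` is moved to a side containing `u`. -/
theorem IsSep.insert_erase {G : SimpleGraph V} {v u : V}
    (hdeg : ∀ x : V, G.Adj v x → x = u) {A B : Finset V}
    (hs : IsSep (G.deleteEdges {s(v, u)}) A B) (hu : u ∈ A) :
    IsSep G (insert v A) (B.erase v) ∧ (insert v A ∩ B.erase v).card ≤ (A ∩ B).card := by
  refine ⟨⟨?_, fun a ha b hb hab => ?_⟩, Finset.card_le_card fun x hx => ?_⟩
  · ext x
    have := Finset.ext_iff.1 hs.1 x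
    simp only [Finset.mem_union, Finset.mem_univ, iff_true, Finset.mem_insert,
      Finset.mem_erase] at this ⊢
    tauto
  · simp only [Finset.mem_sdiff, Finset.mem_insert, Finset.mem_erase] at ha hb
    have hbv : b ≠ v := hb.1.1
    by_cases hav : a = v
    · subst hav
      exact hb.2 (Or.inr (hdeg b hab ▸ hu))
    · refine hs.2 a (by simp; tauto) b (by simp; tauto) ?_
      simp [SimpleGraph.deleteEdges_adj, hab, hav, hbv]
  · simp only [Finset.mem_inter, Finset.mem_insert, Finset.mem_erase] at hx ⊢
    tauto

theorem IsSep.symm {G : SimpleGraph V} {A B : Finset V} (hs : IsSep G A B) : IsSep G B A :=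
  ⟨by rw [Finset.union_comm, hs.1], fun a ha b hb h => hs.2 b hb a ha h.symm⟩

theorem IsSep.of_le {G H : SimpleGraph V} (hle : H ≤ G) {A B : Finset V} (hs : IsSep G A B) :
    IsSep H A B :=
  ⟨hs.1, fun a ha b hb h => hs.2 a ha b hb (hle h)⟩

/-- Every separation of `G - vu`, where `v` is a leaf of `G` with neighbour `u`, differs only in
`v` from a separation of `G` of no larger order. -/
theorem IsSep.exists_erase_eq {G : SimpleGraph V} {v u : V}
    (hdeg : ∀ x : V, G.Adj v x → x = u) {A B : Finset V}
    (hs : IsSep (G.deleteEdges {s(v, u)}) A B) :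
    ∃ A' B', IsSep G A' B' ∧ (A' ∩ B').card ≤ (A ∩ B).card ∧
      A'.erase v = A.erase v ∧ B'.erase v = B.erase v := by
  have hmem := Finset.ext_iff.1 hs.1 u
  simp only [Finset.mem_union, Finset.mem_univ, iff_true] at hmem
  rcases hmem with hu | hu
  · obtain ⟨h, hc⟩ := hs.insert_erase hdeg hu
    exact ⟨_, _, h, hc, by simp, by simp⟩
  · obtain ⟨h, hc⟩ := hs.symm.insert_erase hdeg hu
    refine ⟨_, _, h.symm, ?_, by simp, by simp⟩
    rwa [Finset.inter_comm, Finset.inter_comm A]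

/-- The oriented separations of `H` of order less than `k` that differ only in `v` from an
element of `τ`. -/
def liftTangle (H : SimpleGraph V) (k : ℕ) (v : V) (τ : Set (Finset V × Finset V)) :
    Set (Finset V × Finset V) :=
  {p | (IsSep H p.1 p.2 ∧ (p.1 ∩ p.2).card < k) ∧
    ∃ q ∈ τ, q.1.erase v = p.1.erase v ∧ q.2.erase v = p.2.erase v}

theorem IsTangle.liftTangle {k : ℕ} (hk : 3 ≤ k) {G : SimpleGraph V}
    {τ : Set (Finset V × Finset V)} (hτ : IsTangle G k τ)
    {v u : V} (hvu : G.Adj v u) (hdeg : ∀ x : V, G.Adj v x → x = u) :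
    IsTangle (G.deleteEdges {s(v, u)}) k (liftTangle (G.deleteEdges {s(v, u)}) k v τ) := by
  have hext : ∀ p ∈ _root_.liftTangle (G.deleteEdges {s(v, u)}) k v τ,
      ∃ q ∈ τ, (u ∈ p.1 → v ∈ q.1) ∧ ∀ x, x ≠ v → x ∈ p.1 → x ∈ q.1 := by
    rintro ⟨A, B⟩ ⟨⟨hs, hc⟩, ⟨A', B'⟩, hq, hA, hB⟩
    by_cases hu : u ∈ A
    · obtain ⟨h, hc'⟩ := hs.insert_erase hdeg hu
      exact ⟨_, hτ.mem_of_erase_eq hk hdeg hq h (hc'.trans_lt hc) (by simpa using hA.symm)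
        (by simpa using hB.symm), by simp, fun x hx hxA => by simp_all⟩
    · refine ⟨_, hq, fun h => absurd h hu, fun x hx hxA => ?_⟩
      simpa [hx, show x ∈ A from hxA] using Finset.ext_iff.1 hA x
  refine ⟨fun p hp => hp.1, fun A B hs hc => ⟨?_, fun h => ?_⟩, ?_⟩
  · rintro ⟨-, ⟨A', B'⟩, hq, hA, hB⟩ ⟨-, ⟨B'', A''⟩, hq', hB', hA'⟩
    obtain ⟨hs', hc'⟩ := hτ.1 _ hq
    refine (hτ.2.1 A' B' hs' hc').1 hq ?_
    refine hτ.mem_of_erase_eq hk hdeg hq' hs'.symm ?_ (hB.trans hB'.symm) (hA.trans hA'.symm)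
    rwa [Finset.inter_comm]
  · refine ⟨⟨hs, hc⟩, ?_⟩
    obtain ⟨A', B', hs', hc', hA, hB⟩ := hs.exists_erase_eq hdeg
    refine ⟨(A', B'), ?_, hA, hB⟩
    by_contra hn
    exact h ⟨⟨hs.symm, by rwa [Finset.inter_comm]⟩, _,
      hτ.mem_swap hs' (hc'.trans_lt hc) hn, hB, hA⟩
  · intro p₁ h₁ p₂ h₂ p₃ h₃ hcov
    obtain ⟨q₁, hq₁, hu₁, hx₁⟩ := hext _ h₁
    obtain ⟨q₂, hq₂, hu₂, hx₂⟩ := hext _ h₂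
    obtain ⟨q₃, hq₃, hu₃, hx₃⟩ := hext _ h₃
    have hne := hvu.ne'
    have hpair : (v ∈ q₁.1 ∧ u ∈ q₁.1) ∨ (v ∈ q₂.1 ∧ u ∈ q₂.1) ∨ (v ∈ q₃.1 ∧ u ∈ q₃.1) := by
      rcases hcov.1 u with h | h | h
      · exact Or.inl ⟨hu₁ h, hx₁ u hne h⟩
      · exact Or.inr (Or.inl ⟨hu₂ h, hx₂ u hne h⟩)
      · exact Or.inr (Or.inr ⟨hu₃ h, hx₃ u hne h⟩)
    refine hτ.2.2 _ hq₁ _ hq₂ _ hq₃ ⟨fun x => ?_, fun x y hxy => ?_⟩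
    · by_cases hx : x = v
      · subst hx
        tauto
      · exact (hcov.1 x).imp (hx₁ x hx) (Or.imp (hx₂ x hx) (hx₃ x hx))
    · by_cases hx : x = v
      · subst hx
        rwa [hdeg y hxy]
      by_cases hy : y = v
      · subst hy
        rw [hdeg x hxy.symm]
        tauto
      have hadj : (G.deleteEdges {s(v, u)}).Adj x y := by
        simp [SimpleGraph.deleteEdges_adj, hxy, hx, hy]
      exact (hcov.2 x y hadj).imp (And.imp (hx₁ x hx) (hx₁ y hy))
        (Or.imp (And.imp (hx₂ x hx) (hx₂ y hy)) (And.imp (hx₃ x hx) (hx₃ y hy)))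

/-- Let `τ` be a `k`-tangle (`k ≥ 3`) in `G`, let `v` be a vertex of degree `1` whose unique
incident edge is `e = vu`.  Then `τ` extends to exactly one `k`-tangle in `G - e`. -/
theorem stmt8 (k : ℕ) (hk : 3 ≤ k) (G : SimpleGraph V)
    (τ : Set (Finset V × Finset V)) (hτ : IsTangle G k τ)
    (v u : V) (hvu : G.Adj v u) (hdeg : ∀ x : V, G.Adj v x → x = u) :
    ∃! τ' : Set (Finset V × Finset V),
      IsTangle (G.deleteEdges {s(v, u)}) k τ' ∧ τ ⊆ τ' := by
  have hle : G.deleteEdges {s(v, u)} ≤ G := G.deleteEdges_le _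
  have hlift := hτ.liftTangle hk hvu hdeg
  refine ⟨_, ⟨hlift, fun p hp => ?_⟩, ?_⟩
  · exact ⟨⟨(hτ.1 p hp).1.of_le hle, (hτ.1 p hp).2⟩, p, hp, rfl, rfl⟩
  rintro σ ⟨hσ, hτσ⟩
  have hsub : liftTangle (G.deleteEdges {s(v, u)}) k v τ ⊆ σ := by
    rintro ⟨A, B⟩ ⟨⟨hs, hc⟩, q, hq, hA, hB⟩
    exact hσ.mem_of_erase_eq hk (fun x hx => hdeg x (hle hx)) (hτσ hq) hs hc hA.symm hB.symm
  refine Set.Subset.antisymm ?_ hsub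
  rintro ⟨A, B⟩ hp
  obtain ⟨hs, hc⟩ := hσ.1 _ hp
  by_contra hn
  exact (hσ.2.1 A B hs hc).1 hp (hsub (hlift.mem_swap hs hc hn))
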